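/- Let d ≥ 1 and let I : C^{1,1}(ℝ^d) → C_b(ℝ^d) be Lipschitz with constant K₀ with respect to the C^{1,1} norm, satisfy the global comparison property, and satisfy the locality assumption (with C^{1,1} norms). Then there exist a constant Λ (depending only on d and K₀) and a family 𝒦 of Lévy-type functionals, each based at some point of ℝ^d and each with |A| ≤ Λ, |B| ≤ Λ, |C| ≤ Λ and ∫ min(1,|y−x|²) dμ(y) ≤ Λ, such that: (i) for all u, v ∈ C²_b(ℝ^d) and all x ∈ ℝ^d there exists L ∈ 𝒦 based at x with I(u)(x) ≤ I(v)(x) + L(u − v); and consequently (ii) for every u ∈ C²_b(ℝ^d) and every x ∈ ℝ^d, I(u)(x) = inf over v ∈ C²_b(ℝ^d) of the sup over L ∈ 𝒦 based at x of ( I(v)(x) + L(u − v) ), the infimum being attained at v = u. -/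

import Mathlib

open MeasureTheory Metric Filter Set

noncomputable section

abbrev Euc (d : ℕ) := EuclideanSpace ℝ (Fin d)

variable {d : ℕ}

def supNorm (u : Euc d → ℝ) : ℝ := ⨆ x, |u x|

def gradSup (u : Euc d → ℝ) : ℝ := ⨆ x, ‖fderiv ℝ u x‖

def hessSup (u : Euc d → ℝ) : ℝ := ⨆ x, ‖iteratedFDeriv ℝ 2 u x‖

/-- the `C²` norm : `sup|u| + sup|∇u| + sup|D²u|` -/
def C2Norm (u : Euc d → ℝ) : ℝ := supNorm u + gradSup u + hessSup u

/-- membership in `C²_b(ℝ^d)` -/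
def IsC2b (u : Euc d → ℝ) : Prop :=
  ContDiff ℝ 2 u ∧ ∃ M : ℝ, ∀ x, |u x| ≤ M ∧ ‖fderiv ℝ u x‖ ≤ M ∧ ‖iteratedFDeriv ℝ 2 u x‖ ≤ M

/-- membership in `C_b(ℝ^d)` -/
def IsCb (f : Euc d → ℝ) : Prop := Continuous f ∧ ∃ M : ℝ, ∀ x, |f x| ≤ M

/-- Lipschitz seminorm of the gradient -/
def gradLipSemi (u : Euc d → ℝ) : ℝ :=
  sInf {M : ℝ | 0 ≤ M ∧ ∀ x y, ‖fderiv ℝ u x - fderiv ℝ u y‖ ≤ M * ‖x - y‖}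

/-- the `C^{1,1}` norm : `sup|u| + sup|∇u| + Lip(∇u)` -/
def C11Norm (u : Euc d → ℝ) : ℝ := supNorm u + gradSup u + gradLipSemi u

/-- membership in `C^{1,1}(ℝ^d)` : bounded `C¹` functions with Lipschitz gradient -/
def IsC11 (u : Euc d → ℝ) : Prop :=
  ContDiff ℝ 1 u ∧ (∃ M : ℝ, ∀ x, |u x| ≤ M ∧ ‖fderiv ℝ u x‖ ≤ M) ∧
    ∃ M : ℝ, ∀ x y, ‖fderiv ℝ u x - fderiv ℝ u y‖ ≤ M * ‖x - y‖

def GCP (dom : (Euc d → ℝ) → Prop) (I : (Euc d → ℝ) → Euc d → ℝ) : Prop :=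
  ∀ u v, dom u → dom v → (∀ y, u y ≤ v y) → ∀ x, u x = v x → I u x ≤ I v x

def LipWith (K₀ : ℝ) (dom : (Euc d → ℝ) → Prop) (N : (Euc d → ℝ) → ℝ)
    (I : (Euc d → ℝ) → Euc d → ℝ) : Prop :=
  ∀ u v, dom u → dom v → ∀ x, |I u x - I v x| ≤ K₀ * N (fun y => u y - v y)

def localSup (r : ℝ) (u : Euc d → ℝ) : ℝ := ⨆ x ∈ closedBall (0 : Euc d) r, |u x|

def localGradSup (r : ℝ) (u : Euc d → ℝ) : ℝ :=
  ⨆ x ∈ closedBall (0 : Euc d) r, ‖fderiv ℝ u x‖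

/-- Lipschitz seminorm of the gradient restricted to the closed ball of radius `r` -/
def localGradLipSemi (r : ℝ) (u : Euc d → ℝ) : ℝ :=
  sInf {M : ℝ | 0 ≤ M ∧ ∀ x ∈ closedBall (0 : Euc d) r, ∀ y ∈ closedBall (0 : Euc d) r,
    ‖fderiv ℝ u x - fderiv ℝ u y‖ ≤ M * ‖x - y‖}

/-- the `C^{1,1}` norm restricted to the closed ball of radius `r` -/
def localC11Norm (r : ℝ) (u : Euc d → ℝ) : ℝ :=
  localSup r u + localGradSup r u + localGradLipSemi r u

def Locality (dom : (Euc d → ℝ) → Prop) (locN : ℝ → (Euc d → ℝ) → ℝ)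
    (I : (Euc d → ℝ) → Euc d → ℝ) : Prop :=
  ∃ C₀ : ℝ, ∃ ω : ℝ → ℝ, (∀ r > (0 : ℝ), 0 < ω r) ∧ Tendsto ω atTop (nhds 0) ∧
    ∃ r₀ : ℝ, ∀ r ≥ r₀, ∀ u v, dom u → dom v → ∀ x : Euc d, ‖x‖ ≤ r →
      |I u x - I v x| ≤ C₀ * locN (2 * r) (fun y => u y - v y)
        + C₀ * ω r * supNorm (fun y => u y - v y)

structure LevyData (d : ℕ) where
  base : Euc d
  A : Matrix (Fin d) (Fin d) ℝ
  B : Euc d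
  C : ℝ
  μ : Measure (Euc d)

def LevyData.apply (L : LevyData d) (u : Euc d → ℝ) : ℝ :=
  (∑ i, ∑ j, L.A i j *
      iteratedFDeriv ℝ 2 u L.base ![EuclideanSpace.single i (1:ℝ), EuclideanSpace.single j (1:ℝ)])
    + fderiv ℝ u L.base L.B + L.C * u L.base
    + ∫ y, (u y - u L.base -
        Set.indicator (ball L.base 1) (fun z => fderiv ℝ u L.base (z - L.base)) y) ∂L.μ

def LevyBounds (Λ : ℝ) (L : LevyData d) : Prop :=
  L.A.IsSymm ∧ L.A.PosSemidef ∧ (∀ i j, |L.A i j| ≤ Λ) ∧ ‖L.B‖ ≤ Λ ∧ |L.C| ≤ Λ ∧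
    L.μ {L.base} = 0 ∧
    (∫⁻ y, ENNReal.ofReal (min 1 (‖y - L.base‖ ^ 2)) ∂L.μ) ≤ ENNReal.ofReal Λ

/-- quantitative `C^{1,1}` bound, vector valued -/
def PB {G : Type*} [NormedAddCommGroup G] [NormedSpace ℝ G] (f : Euc d → G) (M : ℝ) : Prop :=
  ContDiff ℝ 1 f ∧ (∀ x, ‖f x‖ ≤ M) ∧ (∀ x, ‖fderiv ℝ f x‖ ≤ M) ∧
    ∀ x y, ‖fderiv ℝ f x - fderiv ℝ f y‖ ≤ M * ‖x - y‖

section PBlemmas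
variable {G : Type*} [NormedAddCommGroup G] [NormedSpace ℝ G]
variable {H : Type*} [NormedAddCommGroup H] [NormedSpace ℝ H]

theorem PB.nonneg {f : Euc d → G} {M : ℝ} (h : PB f M) : 0 ≤ M :=
  (norm_nonneg _).trans (h.2.1 0)

theorem PB.diff {f : Euc d → G} {M : ℝ} (h : PB f M) : Differentiable ℝ f :=
  h.1.differentiable (by norm_num)

theorem PB.mono {f : Euc d → G} {M N : ℝ} (h : PB f M) (hMN : M ≤ N) : PB f N :=
  ⟨h.1, fun x => (h.2.1 x).trans hMN, fun x => (h.2.2.1 x).trans hMN, fun x y =>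
    (h.2.2.2 x y).trans (by gcongr)⟩

theorem PB.add {f g : Euc d → G} {M N : ℝ} (hf : PB f M) (hg : PB g N) :
    PB (fun y => f y + g y) (M + N) := by
  have e : ∀ x, fderiv ℝ (fun y => f y + g y) x = fderiv ℝ f x + fderiv ℝ g x := fun x =>
    fderiv_fun_add (hf.diff x) (hg.diff x)
  refine ⟨hf.1.add hg.1, fun x => norm_add_le_of_le (hf.2.1 x) (hg.2.1 x), fun x => ?_,
    fun x y => ?_⟩
  · rw [e]; exact norm_add_le_of_le (hf.2.2.1 x) (hg.2.2.1 x)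
  · rw [e, e, add_sub_add_comm, add_mul]
    exact norm_add_le_of_le (hf.2.2.2 x y) (hg.2.2.2 x y)

theorem PB.clm {f : Euc d → G} {M : ℝ} (hf : PB f M) (l : G →L[ℝ] H) :
    PB (fun y => l (f y)) (‖l‖ * M) := by
  have e : ∀ x, fderiv ℝ (fun y => l (f y)) x = l.comp (fderiv ℝ f x) := fun x =>
    (l.hasFDerivAt.comp x (hf.diff x).hasFDerivAt).fderiv
  refine ⟨l.contDiff.comp hf.1, fun x => l.le_opNorm_of_le (hf.2.1 x), fun x => ?_,
    fun x y => ?_⟩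
  · rw [e]
    exact (l.opNorm_comp_le _).trans (by gcongr; exact hf.2.2.1 x)
  · rw [e, e, ← ContinuousLinearMap.comp_sub, mul_assoc]
    exact (l.opNorm_comp_le _).trans (by gcongr; exact hf.2.2.2 x y)

theorem PB.const (c : G) : PB (fun _ : Euc d => c) ‖c‖ := by
  refine ⟨contDiff_const, fun _ => le_rfl, fun x => by simp, fun x y => ?_⟩
  simp only [fderiv_fun_const, Pi.zero_apply, sub_self, norm_zero]
  positivity

theorem PB.trans' {f : Euc d → G} {M : ℝ} (hf : PB f M) (a : Euc d) :
    PB (fun y => f (y - a)) M := by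
  have e : ∀ x, fderiv ℝ (fun y => f (y - a)) x = fderiv ℝ f (x - a) := fun x =>
    fderiv_comp_sub a
  refine ⟨hf.1.comp (contDiff_id.sub contDiff_const), fun x => hf.2.1 _, fun x => ?_,
    fun x y => ?_⟩
  · rw [e]; exact hf.2.2.1 _
  · rw [e, e]; simpa using hf.2.2.2 (x - a) (y - a)

theorem PB.of_C2 {f : Euc d → G} {M : ℝ} (hf : ContDiff ℝ 2 f) (h0 : ∀ x, ‖f x‖ ≤ M)
    (h1 : ∀ x, ‖fderiv ℝ f x‖ ≤ M) (h2 : ∀ x, ‖fderiv ℝ (fderiv ℝ f) x‖ ≤ M) : PB f M := by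
  refine ⟨hf.of_le (by norm_num), h0, h1, fun x y => ?_⟩
  have hd : Differentiable ℝ (fderiv ℝ f) :=
    (hf.fderiv_right (m := 1) (by norm_num)).differentiable (by norm_num)
  exact convex_univ.norm_image_sub_le_of_norm_fderiv_le (fun z _ => hd z) (fun z _ => h2 z)
    (mem_univ y) (mem_univ x)

theorem real_bdd {h : Euc d → ℝ} (hc : Continuous h) (hs : HasCompactSupport h) :
    ∃ C, ∀ x, h x ≤ C := by
  obtain ⟨C, hC⟩ := hc.bounded_above_of_compact_support hs
  exact ⟨C, fun x => (le_abs_self _).trans (hC x)⟩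

theorem fderiv_bdd {f : Euc d → G} (hf : ContDiff ℝ 1 f) (hc : HasCompactSupport f) :
    ∃ C, ∀ x, ‖fderiv ℝ f x‖ ≤ C := by
  have c1 : Continuous (fderiv ℝ f) := hf.continuous_fderiv (by norm_num)
  have s1 : HasCompactSupport (fderiv ℝ f) := hc.fderiv ℝ
  exact real_bdd c1.norm s1.norm

theorem PB.of_compact {f : Euc d → G} (hf : ContDiff ℝ 2 f) (hc : HasCompactSupport f) :
    ∃ M, PB f M := by
  have c2 : ContDiff ℝ 1 (fderiv ℝ f) := hf.fderiv_right (m := 1) (by norm_num)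
  have s1 : HasCompactSupport (fderiv ℝ f) := hc.fderiv ℝ
  obtain ⟨a, ha⟩ : ∃ C, ∀ x, ‖f x‖ ≤ C := real_bdd hf.continuous.norm hc.norm
  obtain ⟨b, hb⟩ := fderiv_bdd (hf.of_le (by norm_num)) hc
  obtain ⟨c, hcc⟩ := fderiv_bdd c2 s1
  exact ⟨max a (max b c), PB.of_C2 hf (fun x => (ha x).trans (le_max_left _ _))
    (fun x => (hb x).trans ((le_max_left _ _).trans (le_max_right _ _)))
    (fun x => (hcc x).trans ((le_max_right _ _).trans (le_max_right _ _)))⟩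

end PBlemmas

theorem PB.isC11 {f : Euc d → ℝ} {M : ℝ} (h : PB f M) : IsC11 f :=
  ⟨h.1, ⟨M, fun x => ⟨h.2.1 x, h.2.2.1 x⟩⟩, ⟨M, h.2.2.2⟩⟩

theorem PB.norm_le {f : Euc d → ℝ} {M : ℝ} (h : PB f M) : C11Norm f ≤ 3 * M := by
  have h1 : supNorm f ≤ M := ciSup_le h.2.1
  have h2 : gradSup f ≤ M := ciSup_le h.2.2.1
  have h3 : gradLipSemi f ≤ M := csInf_le ⟨0, fun m hm => hm.1⟩ ⟨h.nonneg, h.2.2.2⟩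
  unfold C11Norm; linarith

theorem norm_fderiv_two (f : Euc d → ℝ) (x : Euc d) :
    ‖fderiv ℝ (fderiv ℝ f) x‖ = ‖iteratedFDeriv ℝ 2 f x‖ := by
  rw [← norm_iteratedFDeriv_fderiv, ← norm_iteratedFDeriv_fderiv, norm_iteratedFDeriv_zero]

theorem IsC2b.pb {f : Euc d → ℝ} (h : IsC2b f) : ∃ M, PB f M := by
  obtain ⟨hf, M, hM⟩ := h
  exact ⟨M, PB.of_C2 hf (fun x => (hM x).1) (fun x => (hM x).2.1)
    (fun x => by rw [norm_fderiv_two]; exact (hM x).2.2)⟩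

theorem IsC2b.sub {f g : Euc d → ℝ} (hf : IsC2b f) (hg : IsC2b g) :
    IsC2b (fun y => f y - g y) := by
  obtain ⟨hf, M, hM⟩ := hf
  obtain ⟨hg, N, hN⟩ := hg
  refine ⟨hf.sub hg, M + N, fun x => ⟨?_, ?_, ?_⟩⟩
  · exact (abs_sub (f x) (g x)).trans (add_le_add (hM x).1 (hN x).1)
  · rw [fderiv_fun_sub (hf.differentiable (by norm_num) x) (hg.differentiable (by norm_num) x)]
    exact norm_sub_le_of_le (hM x).2.1 (hN x).2.1
  · have : iteratedFDeriv ℝ 2 (fun y => f y - g y) x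
        = iteratedFDeriv ℝ 2 f x - iteratedFDeriv ℝ 2 g x :=
      iteratedFDeriv_sub_apply hf.contDiffAt hg.contDiffAt
    rw [this]
    exact norm_sub_le_of_le (hM x).2.2 (hN x).2.2

/-- the Lévy increment -/
def incr (w : Euc d → ℝ) (x y : Euc d) : ℝ :=
  w y - w x - Set.indicator (ball x 1) (fun z => fderiv ℝ w x (z - x)) y

theorem incr_bound {w : Euc d → ℝ} {M : ℝ} (h : PB w M) (x y : Euc d) :
    |incr w x y| ≤ 2 * M * min 1 (‖y - x‖ ^ 2) := by
  have hM := h.nonneg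
  unfold incr
  by_cases hy : y ∈ ball x 1
  · rw [indicator_of_mem hy]
    have hy' : ‖y - x‖ < 1 := by simpa [dist_eq_norm] using hy
    have hm : min 1 (‖y - x‖ ^ 2) = ‖y - x‖ ^ 2 := by
      apply min_eq_right
      have := norm_nonneg (y - x)
      nlinarith
    rw [hm]
    have := (convex_closedBall x ‖y - x‖).norm_image_sub_le_of_norm_fderiv_le' (𝕜 := ℝ)
      (f := w) (C := M * ‖y - x‖) (φ := fderiv ℝ w x) (x := x) (y := y)
      (fun z _ => h.diff z)
      (fun z hz => (h.2.2.2 z x).trans (by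
        gcongr; simpa [dist_eq_norm] using hz))
      (by simp) (by simp [dist_eq_norm])
    rw [Real.norm_eq_abs] at this
    refine this.trans ?_
    have := mul_nonneg hM (sq_nonneg ‖y - x‖)
    nlinarith
  · rw [indicator_of_notMem hy]
    have hy' : 1 ≤ ‖y - x‖ := by simpa [dist_eq_norm] using hy
    rw [min_eq_left (by nlinarith), sub_zero, mul_one, two_mul]
    exact norm_sub_le_of_le (h.2.1 y) (h.2.1 x)

theorem exists_measure {w : Euc d → ℝ} {M : ℝ} (h : PB w M) (x : Euc d) {T : ℝ} (hT : 0 ≤ T) :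
    ∃ S : ℝ, 0 ≤ S ∧ (∀ y, incr w x y ≤ S * min 1 (‖y - x‖ ^ 2)) ∧
      ∃ μ : Measure (Euc d), μ {x} = 0 ∧
        (∫⁻ y, ENNReal.ofReal (min 1 (‖y - x‖ ^ 2)) ∂μ) ≤ ENNReal.ofReal (2 * T) ∧
        T * S ≤ ∫ y, incr w x y ∂μ := by
  have hM := h.nonneg
  set m : Euc d → ℝ := fun y => min 1 (‖y - x‖ ^ 2) with hm
  have hm0 : ∀ y, 0 ≤ m y := fun y => le_min zero_le_one (by positivity)
  have hmp : ∀ y, y ≠ x → 0 < m y := fun y hy =>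
    lt_min one_pos (pow_pos (norm_pos_iff.2 (sub_ne_zero.2 hy)) 2)
  have hmx : m x = 0 := by simp [hm]
  set Q : Euc d → ℝ := fun y => incr w x y / m y with hQ
  have hQb : BddAbove (range Q) := by
    refine ⟨2 * M, ?_⟩
    rintro _ ⟨y, rfl⟩
    exact div_le_of_le_mul₀ (hm0 y) (by positivity) ((le_abs_self _).trans (incr_bound h x y))
  have hQx : Q x = 0 := by simp [hQ, hmx]
  have hS0 : 0 ≤ ⨆ y, Q y := hQx ▸ le_ciSup hQb x
  refine ⟨⨆ y, Q y, hS0, fun y => ?_, ?_⟩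
  · by_cases hy : y = x
    · subst hy
      have : incr w y y = 0 := by
        have := incr_bound h y y
        simpa using this
      rw [this]; exact mul_nonneg hS0 (hm0 y)
    · exact (div_le_iff₀ (hmp y hy)).1 (le_ciSup hQb y)
  · rcases hS0.eq_or_lt with h0 | hpos
    · exact ⟨0, by simp, by simp, by simp [← h0]⟩
    · obtain ⟨y, hy⟩ := exists_lt_of_lt_ciSup (half_lt_self hpos)
      have hyx : y ≠ x := by
        rintro rfl
        rw [hQx] at hy; linarith
      have hc : 0 ≤ 2 * T / m y := div_nonneg (by positivity) (hm0 y)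
      refine ⟨ENNReal.ofReal (2 * T / m y) • Measure.dirac y, ?_, ?_, ?_⟩
      · simp [hyx]
      · rw [lintegral_smul_measure, lintegral_dirac, smul_eq_mul, ← ENNReal.ofReal_mul hc]
        apply ENNReal.ofReal_le_ofReal
        exact (div_mul_cancel₀ _ (hmp y hyx).ne').le
      · rw [integral_smul_measure, integral_dirac, ENNReal.toReal_ofReal hc, smul_eq_mul]
        have : 2 * T / m y * incr w x y = 2 * T * Q y := by simp only [hQ]; ring
        rw [this]
        nlinarith

theorem exists_eta (d : ℕ) : ∃ η : Euc d → ℝ, ContDiff ℝ 2 η ∧ HasCompactSupport η ∧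
    (∀ z, 0 ≤ η z) ∧ (∀ z, η z ≤ 1) ∧ (∀ z, ‖z‖ < 1 → η z = 1) ∧ (∀ z, 2 ≤ ‖z‖ → η z = 0) := by
  let η : ContDiffBump (0 : Euc d) := ⟨1, 2, one_pos, one_lt_two⟩
  refine ⟨η, η.contDiff, η.hasCompactSupport, fun z => η.nonneg, fun z => η.le_one,
    fun z hz => η.one_of_mem_closedBall ?_, fun z hz => η.zero_of_le_dist ?_⟩
  · rw [mem_closedBall, dist_zero_right]; exact hz.le
  · rw [dist_zero_right]; exact hz

theorem exists_bumps (d : ℕ) : ∃ M : ℝ, 0 ≤ M ∧ ∃ F : Euc d → Euc d, ∃ g : Euc d → ℝ,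
    PB F M ∧ PB g M ∧ F 0 = 0 ∧ g 0 = -1 ∧
    (∀ z, ‖z‖ < 1 → F z = z ∧ 1 + g z = ‖z‖ ^ 2) ∧
    (∀ z, 1 ≤ ‖z‖ → ‖F z‖ ≤ 2 ∧ 0 ≤ g z) := by
  obtain ⟨η, hη, hηc, h0, hle, hone, hzero⟩ := exists_eta d
  have f1 : ContDiff ℝ 2 (fun z : Euc d => η z • z) := hη.smul contDiff_id
  have f2 : ContDiff ℝ 2 (fun z : Euc d => η z * (‖z‖ ^ 2 - 1)) :=
    hη.mul ((contDiff_norm_sq ℝ).sub contDiff_const)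
  have s1 : HasCompactSupport (fun z : Euc d => η z • z) :=
    hηc.mono fun z hz h => hz (by simp only [h, zero_smul])
  have s2 : HasCompactSupport (fun z : Euc d => η z * (‖z‖ ^ 2 - 1)) :=
    hηc.mono fun z hz h => hz (by simp only [h, zero_mul])
  obtain ⟨M1, h1⟩ := PB.of_compact f1 s1
  obtain ⟨M2, h2⟩ := PB.of_compact f2 s2
  refine ⟨max M1 M2, le_max_of_le_left h1.nonneg, _, _, h1.mono (le_max_left _ _),
    h2.mono (le_max_right _ _), smul_zero _, ?_, ?_, ?_⟩
  · have := hone 0 (by simp)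
    simp [this]
  · intro z hz
    have := hone z hz
    simp [this]
  · intro z hz
    refine ⟨?_, mul_nonneg (h0 z) (by nlinarith)⟩
    rw [norm_smul, Real.norm_of_nonneg (h0 z)]
    rcases lt_or_ge ‖z‖ 2 with h2 | h2
    · have := hle z
      have := h0 z
      nlinarith [norm_nonneg z]
    · rw [hzero z h2]; simp

theorem exists_levy (d : ℕ) (K₀ : ℝ) (hK₀ : 0 ≤ K₀) :
    ∃ Λ : ℝ, 0 < Λ ∧
      ∀ I : (Euc d → ℝ) → Euc d → ℝ, LipWith K₀ IsC11 C11Norm I → GCP IsC11 I →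
        ∀ u v, IsC2b u → IsC2b v → ∀ x : Euc d,
          ∃ L : LevyData d, LevyBounds Λ L ∧ L.base = x ∧
            I u x ≤ I v x + L.apply (fun y => u y - v y) := by
  obtain ⟨M, hM, F, g, hF, hg, hF0, hg0, hin, hout⟩ := exists_bumps d
  set T : ℝ := K₀ * (3 * (3 * M + 3)) with hT
  have hT0 : 0 ≤ T := by positivity
  refine ⟨2 * T + 1, by positivity, fun I hLip hGCP u v hu hv x => ?_⟩
  obtain ⟨Mu, hMu⟩ := hu.pb
  obtain ⟨Mv, hMv⟩ := hv.pb
  obtain ⟨Mw, hMw⟩ := (hu.sub hv).pb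
  set w : Euc d → ℝ := fun y => u y - v y with hw
  obtain ⟨S, hS, hSi, μ, hμ0, hμ1, hμ2⟩ := exists_measure hMw x hT0
  set l := fderiv ℝ w x with hl
  set s := S + 2 * ‖l‖ with hs
  have hs0 : 0 ≤ s := by positivity
  set φ : Euc d → ℝ := fun y => w x + l (F (y - x)) + s * (1 + g (y - x)) with hφ
  have hφP : PB φ ((3 * M + 3) * (|w x| + ‖l‖ + S)) := by
    have p1 := PB.const (d := d) (w x)
    have p2 := (hF.trans' x).clm l
    have p3 := ((PB.const (d := d) (1 : ℝ)).add (hg.trans' x)).clm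
      (s • ContinuousLinearMap.id ℝ ℝ)
    have p4 := (p1.add p2).add p3
    have hn : ‖s • ContinuousLinearMap.id ℝ ℝ‖ ≤ s := by
      rw [norm_smul, Real.norm_of_nonneg hs0]
      exact mul_le_of_le_one_right hs0 ContinuousLinearMap.norm_id_le
    refine PB.mono (f := φ) p4 ?_
    rw [Real.norm_eq_abs, norm_one]
    have a1 : ‖s • ContinuousLinearMap.id ℝ ℝ‖ * (1 + M) ≤ s * (1 + M) := by gcongr
    have := abs_nonneg (w x)
    have := norm_nonneg l
    have := mul_nonneg hM (abs_nonneg (w x))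
    have := mul_nonneg hM hS
    rw [hs] at a1
    nlinarith
  have hle : ∀ y, w y ≤ φ y := by
    intro y
    have h1 := hSi y
    unfold incr at h1
    by_cases hy : y ∈ ball x 1
    · have hy' : ‖y - x‖ < 1 := by simpa [dist_eq_norm] using hy
      obtain ⟨e1, e2⟩ := hin _ hy'
      rw [indicator_of_mem hy] at h1
      simp only [hφ, e1, e2, hs]
      have : S * min 1 (‖y - x‖ ^ 2) ≤ S * ‖y - x‖ ^ 2 := by gcongr; exact min_le_right _ _
      have : 0 ≤ 2 * ‖l‖ * ‖y - x‖ ^ 2 := by positivity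
      linarith
    · have hy' : 1 ≤ ‖y - x‖ := by simpa [dist_eq_norm] using hy
      obtain ⟨e1, e2⟩ := hout _ hy'
      rw [indicator_of_notMem hy] at h1
      have b1 : S * min 1 (‖y - x‖ ^ 2) ≤ S * 1 := by gcongr; exact min_le_left _ _
      have b2 := (abs_le.1 (l.le_opNorm_of_le e1)).1
      have b3 := mul_nonneg hs0 e2
      simp only [hφ]
      linarith
  have hφx : φ x = w x := by simp [hφ, hF0, hg0]
  have hPv := hMv.add hφP
  have g1 : I u x ≤ I (fun y => v y + φ y) x :=
    hGCP _ _ hMu.isC11 hPv.isC11 (fun y => by have := hle y; simp only [hw] at this; linarith) x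
      (by rw [hφx]; simp [hw])
  have g2 := (le_abs_self _).trans (hLip _ _ hPv.isC11 hMv.isC11 x)
  have e : (fun y => v y + φ y - v y) = φ := by ext y; ring
  rw [e] at g2
  have g3 := mul_le_mul_of_nonneg_left hφP.norm_le hK₀
  have g4 : I u x - I v x ≤ T * |w x| + T * ‖l‖ + T * S := by
    rw [hT]; linarith
  -- choice of the drift
  obtain ⟨B, hB1, hB2⟩ : ∃ B : Euc d, ‖B‖ ≤ T ∧ l B = T * ‖l‖ := by
    by_cases hl0 : l = 0
    · exact ⟨0, by simpa using hT0, by simp [hl0]⟩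
    · have hln : ‖l‖ ≠ 0 := norm_ne_zero_iff.2 hl0
      let r := (InnerProductSpace.toDual ℝ (Euc d)).symm l
      have hr : ‖r‖ = ‖l‖ := LinearIsometryEquiv.norm_map _ _
      have hlr : l r = ‖l‖ ^ 2 := by
        rw [← hr, ← real_inner_self_eq_norm_sq]
        exact (InnerProductSpace.toDual_symm_apply (x := r) (y := l)).symm
      refine ⟨(T / ‖l‖) • r, ?_, ?_⟩
      · rw [norm_smul, hr, Real.norm_of_nonneg (by positivity), div_mul_cancel₀ _ hln]
      · rw [map_smul, hlr, smul_eq_mul]; field_simp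
  obtain ⟨C, hC1, hC2⟩ : ∃ C : ℝ, |C| ≤ T ∧ C * w x = T * |w x| := by
    rcases le_total 0 (w x) with h | h
    · exact ⟨T, by rw [abs_of_nonneg hT0], by rw [abs_of_nonneg h]⟩
    · exact ⟨-T, by rw [abs_neg, abs_of_nonneg hT0], by rw [abs_of_nonpos h]; ring⟩
  refine ⟨⟨x, 0, B, C, μ⟩, ⟨?_, ?_, ?_, ?_, ?_, hμ0, ?_⟩, rfl, ?_⟩
  · exact Matrix.isSymm_zero
  · exact Matrix.PosSemidef.zero
  · intro i j
    simp only [Matrix.zero_apply, abs_zero]; positivity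
  · simp only; linarith
  · simp only; linarith
  · exact hμ1.trans (ENNReal.ofReal_le_ofReal (by linarith))
  · have : LevyData.apply ⟨x, 0, B, C, μ⟩ w = T * ‖l‖ + T * |w x| + ∫ y, incr w x y ∂μ := by
      simp [LevyData.apply, incr, ← hl, hB2, hC2]
    rw [this]
    linarith

theorem apply_bdd {w : Euc d → ℝ} (hw : IsC2b w) {Λ : ℝ} (hΛ : 0 ≤ Λ) :
    ∃ R : ℝ, ∀ L : LevyData d, LevyBounds Λ L → L.apply w ≤ R := by
  obtain ⟨N, hN⟩ := hw.pb
  obtain ⟨_, M, hM⟩ := hw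
  have hN0 := hN.nonneg
  have hM0 : 0 ≤ M := (abs_nonneg _).trans (hM 0).1
  refine ⟨(∑ _i : Fin d, ∑ _j : Fin d, Λ * M) + M * Λ + Λ * M + 2 * N * Λ, ?_⟩
  rintro ⟨x, A, B, C, μ⟩ ⟨-, -, hA, hB, hC, -, hμ⟩
  simp only at hA hB hC hμ
  unfold LevyData.apply
  refine add_le_add (add_le_add (add_le_add ?_ ?_) ?_) ?_
  · refine Finset.sum_le_sum fun i _ => Finset.sum_le_sum fun j _ => ?_
    refine (le_abs_self _).trans ?_
    rw [abs_mul]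
    refine mul_le_mul (hA i j) ?_ (abs_nonneg _) hΛ
    have := (iteratedFDeriv ℝ 2 w x).le_opNorm
      ![EuclideanSpace.single i (1:ℝ), EuclideanSpace.single j (1:ℝ)]
    simp [Fin.prod_univ_two] at this
    exact this.trans (hM x).2.2
  · refine (le_abs_self _).trans ?_
    exact (ContinuousLinearMap.le_opNorm _ _).trans
      (mul_le_mul (hM x).2.1 hB (norm_nonneg _) hM0)
  · refine (le_abs_self _).trans ?_
    rw [abs_mul]
    exact mul_le_mul hC (hM x).1 (abs_nonneg _) hΛ
  · refine (le_abs_self _).trans ?_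
    rw [← Real.norm_eq_abs]
    refine (norm_integral_le_lintegral_norm _).trans ?_
    refine ENNReal.toReal_le_of_le_ofReal (by positivity) ?_
    calc _ ≤ ∫⁻ y, ENNReal.ofReal (2 * N) * ENNReal.ofReal (min 1 (‖y - x‖ ^ 2)) ∂μ := by
          refine lintegral_mono fun y => ?_
          rw [← ENNReal.ofReal_mul (by positivity)]
          exact ENNReal.ofReal_le_ofReal (incr_bound hN x y)
      _ = ENNReal.ofReal (2 * N) * ∫⁻ y, ENNReal.ofReal (min 1 (‖y - x‖ ^ 2)) ∂μ :=
          lintegral_const_mul' _ _ ENNReal.ofReal_ne_top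
      _ ≤ ENNReal.ofReal (2 * N) * ENNReal.ofReal Λ := by gcongr
      _ = _ := (ENNReal.ofReal_mul (by positivity)).symm

/-- min-max formula for Lipschitz operators `I : C^{1,1}(ℝ^d) → C_b(ℝ^d)`
with the global comparison property and the locality assumption;
the min-max formula holds for `u, v ∈ C²_b(ℝ^d)`. -/
theorem minmax_C11 (d : ℕ) (hd : 1 ≤ d) (K₀ : ℝ) (hK₀ : 0 ≤ K₀) :
    ∃ Λ : ℝ, 0 < Λ ∧
      ∀ I : (Euc d → ℝ) → Euc d → ℝ,
        (∀ u, IsC11 u → IsCb (I u)) →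
        LipWith K₀ IsC11 C11Norm I →
        GCP IsC11 I →
        Locality IsC11 localC11Norm I →
        ∃ 𝒦 : Set (LevyData d),
          (∀ L ∈ 𝒦, LevyBounds Λ L) ∧
          (∀ u v, IsC2b u → IsC2b v → ∀ x : Euc d,
            ∃ L ∈ 𝒦, L.base = x ∧ I u x ≤ I v x + L.apply (fun y => u y - v y)) ∧
          (∀ u, IsC2b u → ∀ x : Euc d,
            I u x = sInf {r : ℝ | ∃ v, IsC2b v ∧
                r = sSup {s : ℝ | ∃ L ∈ 𝒦, L.base = x ∧
                      s = I v x + L.apply (fun y => u y - v y)}} ∧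
            sSup {s : ℝ | ∃ L ∈ 𝒦, L.base = x ∧
                s = I u x + L.apply (fun y => u y - u y)} = I u x) := by
  obtain ⟨Λ, hΛ, key⟩ := exists_levy d K₀ hK₀
  refine ⟨Λ, hΛ, fun I _ hLip hGCP _ => ⟨{L | LevyBounds Λ L}, fun L hL => hL, ?_, ?_⟩⟩
  · intro u v hu hv x
    obtain ⟨L, h1, h2, h3⟩ := key I hLip hGCP u v hu hv x
    exact ⟨L, h1, h2, h3⟩
  · intro u hu x
    have hsup : sSup {s : ℝ | ∃ L ∈ {L : LevyData d | LevyBounds Λ L}, L.base = x ∧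
                s = I u x + L.apply (fun y => u y - u y)} = I u x := by
      have h0 : ∀ L : LevyData d, L.apply (fun y => u y - u y) = 0 := by
        intro L
        have : (fun y => u y - u y) = (fun _ : Euc d => (0 : ℝ)) := by ext; simp
        rw [this]
        simp [LevyData.apply]
      have : {s : ℝ | ∃ L ∈ {L : LevyData d | LevyBounds Λ L}, L.base = x ∧
                s = I u x + L.apply (fun y => u y - u y)} = {I u x} := by
        ext s
        simp only [h0, add_zero, mem_ofPred_eq, mem_singleton_iff]
        constructor
        · rintro ⟨L, _, _, h⟩; exact h
        · intro h
          obtain ⟨L, h1, h2, _⟩ := key I hLip hGCP u u hu hu x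
          exact ⟨L, h1, h2, h⟩
      rw [this, csSup_singleton]
    refine ⟨?_, hsup⟩
    have hleast : IsLeast {r : ℝ | ∃ v, IsC2b v ∧
                r = sSup {s : ℝ | ∃ L ∈ {L : LevyData d | LevyBounds Λ L}, L.base = x ∧
                      s = I v x + L.apply (fun y => u y - v y)}} (I u x) := by
      refine ⟨⟨u, hu, hsup.symm⟩, ?_⟩
      rintro r ⟨v, hv, rfl⟩
      obtain ⟨L, h1, h2, h3⟩ := key I hLip hGCP u v hu hv x
      obtain ⟨R, hR⟩ := apply_bdd (hu.sub hv) hΛ.le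
      refine h3.trans (le_csSup ⟨I v x + R, ?_⟩ ⟨L, h1, h2, rfl⟩)
      rintro s ⟨L', hL', _, rfl⟩
      have := hR L' hL'
      linarith
    exact hleast.csInf_eq.symm

end
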